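/- There is a constant C such that for every finite alphabet Σ, every regular expression r over Σ of size n ≥ 2 has an equivalent regular expression r' with L(r') = L(r) whose depth is at most C·log₂ n; in particular, r' has star height at most C·log₂ n. (This strengthens the result of Gruber and Holzer that every regular expression of size n has an equivalent regular expression of star height O(log n).) -/

import Mathlib

open RegularExpression

/-- The size of a regular expression: the number of nodes of its syntax tree. -/
def reSize {α : Type} : RegularExpression α → ℕ
  | .zero => 1
  | .epsilon => 1
  | .char _ => 1
  | .plus p q => 1 + reSize p + reSize q
  | .comp p q => 1 + reSize p + reSize q
  | .star p => 1 + reSize p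

/-- The depth of a regular expression: the height of its syntax tree. -/
def reDepth {α : Type} : RegularExpression α → ℕ
  | .zero => 1
  | .epsilon => 1
  | .char _ => 1
  | .plus p q => 1 + max (reDepth p) (reDepth q)
  | .comp p q => 1 + max (reDepth p) (reDepth q)
  | .star p => 1 + reDepth p

/-- The star height of a regular expression: the maximal nesting depth of `∗`. -/
def starHeight {α : Type} : RegularExpression α → ℕ
  | .zero => 0
  | .epsilon => 0
  | .char _ => 0
  | .plus p q => max (starHeight p) (starHeight q)
  | .comp p q => max (starHeight p) (starHeight q)
  | .star p => 1 + starHeight p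

/-! ### Kleene algebra identities -/

section KA
open Computability
variable {K : Type} [KleeneAlgebra K]

theorem ka_slide (a b : K) : (a * b)∗ * a = a * (b * a)∗ := by
  apply le_antisymm
  · apply kstar_mul_le
    · calc a = a * 1 := (mul_one a).symm
        _ ≤ a * (b * a)∗ := by gcongr; exact one_le_kstar
    · calc a * b * (a * (b * a)∗) = a * ((b * a) * (b * a)∗) := by simp only [mul_assoc]
        _ ≤ a * (b * a)∗ := by gcongr; exact mul_kstar_le_kstar
  · apply mul_kstar_le
    · calc a = 1 * a := (one_mul a).symm
        _ ≤ (a * b)∗ * a := by gcongr; exact one_le_kstar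
    · calc (a * b)∗ * a * (b * a) = ((a * b)∗ * (a * b)) * a := by simp only [mul_assoc]
        _ ≤ (a * b)∗ * a := by gcongr; exact kstar_mul_le_kstar

theorem ka_denest (a b : K) : (a + b)∗ = a∗ * (b * a∗)∗ := by
  apply le_antisymm
  · apply kstar_le_of_mul_le_right
    · calc (1 : K) = 1 * 1 := (mul_one 1).symm
        _ ≤ a∗ * (b * a∗)∗ := by gcongr <;> exact one_le_kstar
    · rw [add_mul]
      apply add_le
      · rw [← mul_assoc]
        gcongr
        exact mul_kstar_le_kstar
      · calc b * (a∗ * (b * a∗)∗) = (b * a∗) * (b * a∗)∗ := by simp only [mul_assoc]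
          _ ≤ (b * a∗)∗ := mul_kstar_le_kstar
          _ = 1 * (b * a∗)∗ := (one_mul _).symm
          _ ≤ a∗ * (b * a∗)∗ := by gcongr; exact one_le_kstar
  · have h := add_le_iff.1 (le_refl (a + b))
    have ha : a * (a + b)∗ ≤ (a + b)∗ := by
      calc a * (a + b)∗ ≤ (a + b) * (a + b)∗ := by gcongr; exact h.1
        _ ≤ _ := mul_kstar_le_kstar
    have hb : b * (a + b)∗ ≤ (a + b)∗ := by
      calc b * (a + b)∗ ≤ (a + b) * (a + b)∗ := by gcongr; exact h.2
        _ ≤ _ := mul_kstar_le_kstar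
    apply kstar_mul_le
    · apply kstar_le_of_mul_le_right one_le_kstar
      rw [mul_assoc]
      refine le_trans ?_ hb
      gcongr
      exact kstar_mul_le_self ha
    · exact ha

/-- The normal form of a one-hole context. -/
def nf (D A B C X : K) : K := D + A * X * (B * X)∗ * C

/-- Normal forms are closed under composition. -/
theorem nf_comp (D₁ A₁ B₁ C₁ D₂ A₂ B₂ C₂ X : K) :
    nf D₁ A₁ B₁ C₁ (nf D₂ A₂ B₂ C₂ X) =
      nf (D₁ + A₁ * (D₂ * (B₁ * D₂)∗) * C₁)
        (A₁ * (1 + D₂ * (B₁ * D₂)∗ * B₁) * A₂)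
        (B₂ + C₂ * (B₁ * D₂)∗ * B₁ * A₂)
        (C₂ * (B₁ * D₂)∗ * C₁) X := by
  unfold nf
  generalize hM : (B₁ * D₂)∗ = M
  generalize hP : X * (B₂ * X)∗ = P
  have hP' : A₂ * X * (B₂ * X)∗ * C₂ = A₂ * P * C₂ := by rw [← hP]; simp only [mul_assoc]
  have h2 : X * ((B₂ + C₂ * M * B₁ * A₂) * X)∗ = P * (C₂ * M * B₁ * A₂ * P)∗ := by
    rw [add_mul, ka_denest, ← hP]
    simp only [mul_assoc]
  generalize hQ : P * (C₂ * M * B₁ * A₂ * P)∗ = Q at h2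
  have h3 : A₁ * (1 + D₂ * M * B₁) * A₂ * X * ((B₂ + C₂ * M * B₁ * A₂) * X)∗ * (C₂ * M * C₁)
      = A₁ * (1 + D₂ * M * B₁) * A₂ * Q * (C₂ * M * C₁) := by
    rw [← h2]; simp only [mul_assoc]
  rw [hP', h3, mul_add B₁, ka_denest, hM]
  have h4 : A₂ * P * C₂ * M * (B₁ * (A₂ * P * C₂) * M)∗ = A₂ * Q * C₂ * M := by
    have := ka_slide (C₂ * M) (B₁ * A₂ * P)
    have h5 : (C₂ * M) * (B₁ * (A₂ * P * C₂) * M)∗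
        = (C₂ * M * B₁ * A₂ * P)∗ * (C₂ * M) := by
      simp only [mul_assoc] at this ⊢
      exact this.symm
    calc A₂ * P * C₂ * M * (B₁ * (A₂ * P * C₂) * M)∗
        = A₂ * P * ((C₂ * M) * (B₁ * (A₂ * P * C₂) * M)∗) := by simp only [mul_assoc]
      _ = _ := by rw [h5, ← hQ]; simp only [mul_assoc]
  have h6 : (B₁ * (A₂ * P * C₂) * M)∗ = 1 + B₁ * (A₂ * Q * C₂ * M) := by
    rw [← h4, ← one_add_mul_kstar (a := B₁ * (A₂ * P * C₂) * M)]
    congr 1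
    rw [one_add_mul_kstar]
    simp only [mul_assoc]
  have h7 : (D₂ + A₂ * P * C₂) * (M * (B₁ * (A₂ * P * C₂) * M)∗)
      = D₂ * M + (1 + D₂ * M * B₁) * (A₂ * Q * C₂ * M) := by
    have h8 : (A₂ * P * C₂) * (M * (B₁ * (A₂ * P * C₂) * M)∗) = A₂ * Q * C₂ * M := by
      rw [← h4]; simp only [mul_assoc]
    rw [add_mul, h8, h6]
    simp only [mul_add, add_mul, mul_one, one_mul, mul_assoc]
    abel
  rw [mul_assoc A₁ (D₂ + A₂ * P * C₂), h7]
  simp only [mul_add, add_mul, mul_one, one_mul, mul_assoc, add_assoc]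

end KA

/-! ### Languages definable in bounded depth -/

section Depth
open Computability
variable {α : Type}

/-- `L` is denoted by an expression of depth at most `d`. -/
def HasDepth (L : Language α) (d : ℕ) : Prop :=
  ∃ r : RegularExpression α, r.matches' = L ∧ reDepth r ≤ d

theorem HasDepth.mono {L : Language α} {d e : ℕ} (h : HasDepth L d) (hde : d ≤ e) :
    HasDepth L e := by
  obtain ⟨r, h1, h2⟩ := h
  exact ⟨r, h1, h2.trans hde⟩

theorem hasDepth_zero {d : ℕ} (hd : 1 ≤ d) : HasDepth (0 : Language α) d :=
  ⟨.zero, rfl, hd⟩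

theorem hasDepth_one {d : ℕ} (hd : 1 ≤ d) : HasDepth (1 : Language α) d :=
  ⟨.epsilon, rfl, hd⟩

theorem HasDepth.add {L M : Language α} {d e f : ℕ} (h : HasDepth L d) (h' : HasDepth M e)
    (hd : d < f) (he : e < f) : HasDepth (L + M) f := by
  obtain ⟨r, rfl, h2⟩ := h
  obtain ⟨s, rfl, h4⟩ := h'
  refine ⟨.plus r s, rfl, ?_⟩
  simp only [reDepth]
  omega

theorem HasDepth.mul {L M : Language α} {d e f : ℕ} (h : HasDepth L d) (h' : HasDepth M e)
    (hd : d < f) (he : e < f) : HasDepth (L * M) f := by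
  obtain ⟨r, rfl, h2⟩ := h
  obtain ⟨s, rfl, h4⟩ := h'
  refine ⟨.comp r s, rfl, ?_⟩
  simp only [reDepth]
  omega

theorem HasDepth.star {L : Language α} {d f : ℕ} (h : HasDepth L d)
    (hd : d < f) : HasDepth (L∗) f := by
  obtain ⟨r, rfl, h2⟩ := h
  refine ⟨.star r, rfl, ?_⟩
  simp only [reDepth]
  omega

/-- A language operator with a normal form of depth at most `d`. -/
def FunDepth (f : Language α → Language α) (d : ℕ) : Prop :=
  ∃ D A B C : Language α, HasDepth D d ∧ HasDepth A d ∧ HasDepth B d ∧ HasDepth C d ∧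
    ∀ X, f X = nf D A B C X

theorem FunDepth.mono {f : Language α → Language α} {d e : ℕ} (h : FunDepth f d)
    (hde : d ≤ e) : FunDepth f e := by
  obtain ⟨D, A, B, C, h1, h2, h3, h4, h5⟩ := h
  exact ⟨D, A, B, C, h1.mono hde, h2.mono hde, h3.mono hde, h4.mono hde, h5⟩

theorem FunDepth.comp {f g : Language α → Language α} {d : ℕ} (hd : 1 ≤ d)
    (hf : FunDepth f d) (hg : FunDepth g d) : FunDepth (fun X => f (g X)) (d + 7) := by
  obtain ⟨D₁, A₁, B₁, C₁, hD₁, hA₁, hB₁, hC₁, h₁⟩ := hf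
  obtain ⟨D₂, A₂, B₂, C₂, hD₂, hA₂, hB₂, hC₂, h₂⟩ := hg
  have hM : HasDepth ((B₁ * D₂)∗) (d + 2) :=
    (hB₁.mul hD₂ (f := d + 1) (by omega) (by omega)).star (by omega)
  have hN : HasDepth (D₂ * (B₁ * D₂)∗) (d + 3) := hD₂.mul hM (by omega) (by omega)
  refine ⟨D₁ + A₁ * (D₂ * (B₁ * D₂)∗) * C₁, A₁ * (1 + D₂ * (B₁ * D₂)∗ * B₁) * A₂,
    B₂ + C₂ * (B₁ * D₂)∗ * B₁ * A₂, C₂ * (B₁ * D₂)∗ * C₁, ?_, ?_, ?_, ?_,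
    fun X => by beta_reduce; rw [h₁, h₂, nf_comp]⟩
  · have h4 := hA₁.mul hN (f := d + 4) (by omega) (by omega)
    have h5 := h4.mul hC₁ (f := d + 5) (by omega) (by omega)
    exact hD₁.add h5 (by omega) (by omega)
  · have h4 := hN.mul hB₁ (f := d + 4) (by omega) (by omega)
    have h5 := (hasDepth_one (α := α) hd).add h4 (f := d + 5) (by omega) (by omega)
    have h6 := hA₁.mul h5 (f := d + 6) (by omega) (by omega)
    exact h6.mul hA₂ (by omega) (by omega)
  · have h3 := hC₂.mul hM (f := d + 3) (by omega) (by omega)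
    have h4 := h3.mul hB₁ (f := d + 4) (by omega) (by omega)
    have h5 := h4.mul hA₂ (f := d + 5) (by omega) (by omega)
    exact hB₂.add h5 (by omega) (by omega)
  · have h3 := hC₂.mul hM (f := d + 3) (by omega) (by omega)
    exact h3.mul hC₁ (by omega) (by omega)

theorem FunDepth.app {f : Language α → Language α} {X : Language α} {d : ℕ}
    (hf : FunDepth f d) (hX : HasDepth X d) : HasDepth (f X) (d + 5) := by
  obtain ⟨D, A, B, C, hD, hA, hB, hC, h⟩ := hf
  rw [h]
  have h1 := hA.mul hX (f := d + 1) (by omega) (by omega)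
  have h2 := (hB.mul hX (f := d + 1) (by omega) (by omega)).star (f := d + 2) (by omega)
  have h3 := h1.mul h2 (f := d + 3) (by omega) (by omega)
  have h4 := h3.mul hC (f := d + 4) (by omega) (by omega)
  exact hD.add h4 (by omega) (by omega)

/-! ### One-hole contexts -/

/-- One node on the path from the root of an expression to the hole. -/
inductive Frame (α : Type) : Type
  | plus (s : RegularExpression α) : Frame α
  | left (s : RegularExpression α) : Frame α
  | right (s : RegularExpression α) : Frame α
  | star : Frame α

/-- Size of a frame. -/
def Frame.size : Frame α → ℕ
  | .plus s => 1 + reSize s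
  | .left s => 1 + reSize s
  | .right s => 1 + reSize s
  | .star => 1

/-- The language operator of a frame. -/
def Frame.eval : Frame α → Language α → Language α
  | .plus s, X => s.matches' + X
  | .left s, X => s.matches' * X
  | .right s, X => X * s.matches'
  | .star, X => X∗

/-- Size of a context. -/
def ctxSize : List (Frame α) → ℕ
  | [] => 0
  | f :: l => f.size + ctxSize l

/-- The language operator of a context. -/
def ctxEval : List (Frame α) → Language α → Language α
  | [], X => X
  | f :: l, X => f.eval (ctxEval l X)

theorem ctxEval_append (l₁ l₂ : List (Frame α)) (X : Language α) :
    ctxEval (l₁ ++ l₂) X = ctxEval l₁ (ctxEval l₂ X) := by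
  induction l₁ with
  | nil => rfl
  | cons f l ih => simp [ctxEval, ih]

theorem frame_funDepth (f : Frame α) (d : ℕ) (hd : 1 ≤ d)
    (h : ∀ s : RegularExpression α, reSize s < f.size → HasDepth s.matches' d) :
    FunDepth f.eval d := by
  have h0 := hasDepth_zero (α := α) hd
  have h1 := hasDepth_one (α := α) hd
  cases f with
  | plus s =>
    have hs := h s (by simp [Frame.size])
    exact ⟨s.matches', 1, 0, 1, hs, h1, h0, h1, fun X => by simp [nf, Frame.eval]⟩
  | left s =>
    have hs := h s (by simp [Frame.size])
    exact ⟨0, s.matches', 0, 1, h0, hs, h0, h1, fun X => by simp [nf, Frame.eval]⟩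
  | right s =>
    have hs := h s (by simp [Frame.size])
    exact ⟨0, 1, 0, s.matches', h0, h1, h0, hs, fun X => by simp [nf, Frame.eval]⟩
  | star =>
    exact ⟨1, 1, 1, 1, h1, h1, h1, h1, fun X => by
      simp only [nf, Frame.eval, one_mul, mul_one, one_add_mul_kstar]⟩

/-- Splitting a large context at its middle. -/
theorem ctx_split (m : ℕ) (l : List (Frame α)) (hm : 1 ≤ m) (h : m ≤ ctxSize l) :
    ∃ l₁ f l₂, l = l₁ ++ f :: l₂ ∧ ctxSize l₁ < m ∧ ctxSize l₂ + m ≤ ctxSize l ∧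
      f.size ≤ ctxSize l := by
  induction l generalizing m with
  | nil => simp [ctxSize] at h; omega
  | cons f l ih =>
    simp only [ctxSize] at h ⊢
    by_cases hf : m ≤ f.size
    · exact ⟨[], f, l, rfl, by simp [ctxSize]; omega, by omega, by omega⟩
    · obtain ⟨l₁, g, l₂, rfl, h1, h2, h3⟩ := ih (m - f.size) (by omega) (by omega)
      exact ⟨f :: l₁, g, l₂, rfl, by simp [ctxSize]; omega, by omega, by omega⟩

/-- Descending to a smallest heavy subexpression. -/
theorem expr_split (m d : ℕ) (hd : 1 ≤ d)
    (hsmall : ∀ s : RegularExpression α, reSize s < m → HasDepth s.matches' d)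
    (r : RegularExpression α) (h : m ≤ reSize r) :
    ∃ (l : List (Frame α)) (X : Language α), r.matches' = ctxEval l X ∧
      ctxSize l + m ≤ reSize r ∧ HasDepth X (d + 1) := by
  induction r with
  | zero => exact ⟨[], _, rfl, by simpa [ctxSize] using h, ⟨.zero, rfl, by simp [reDepth]⟩⟩
  | epsilon => exact ⟨[], _, rfl, by simpa [ctxSize] using h, ⟨.epsilon, rfl, by simp [reDepth]⟩⟩
  | char a => exact ⟨[], _, rfl, by simpa [ctxSize] using h, ⟨.char a, rfl, by simp [reDepth]⟩⟩
  | plus p q ihp ihq =>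
    by_cases hp : m ≤ reSize p
    · obtain ⟨l, X, h1, h2, h3⟩ := ihp hp
      refine ⟨.plus q :: l, X, ?_, ?_, h3⟩
      · change p.matches' + q.matches' = q.matches' + ctxEval l X
        rw [h1, add_comm]
      · simp only [ctxSize, Frame.size, reSize]; omega
    by_cases hq : m ≤ reSize q
    · obtain ⟨l, X, h1, h2, h3⟩ := ihq hq
      refine ⟨.plus p :: l, X, ?_, ?_, h3⟩
      · change p.matches' + q.matches' = p.matches' + ctxEval l X
        rw [h1]
      · simp only [ctxSize, Frame.size, reSize]; omega
    · refine ⟨[], _, rfl, by simpa [ctxSize] using h, ?_⟩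
      exact (hsmall p (by omega)).add (hsmall q (by omega)) (by omega) (by omega)
  | comp p q ihp ihq =>
    by_cases hp : m ≤ reSize p
    · obtain ⟨l, X, h1, h2, h3⟩ := ihp hp
      refine ⟨.right q :: l, X, ?_, ?_, h3⟩
      · change p.matches' * q.matches' = ctxEval l X * q.matches'
        rw [h1]
      · simp only [ctxSize, Frame.size, reSize]; omega
    by_cases hq : m ≤ reSize q
    · obtain ⟨l, X, h1, h2, h3⟩ := ihq hq
      refine ⟨.left p :: l, X, ?_, ?_, h3⟩
      · change p.matches' * q.matches' = p.matches' * ctxEval l X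
        rw [h1]
      · simp only [ctxSize, Frame.size, reSize]; omega
    · refine ⟨[], _, rfl, by simpa [ctxSize] using h, ?_⟩
      exact (hsmall p (by omega)).mul (hsmall q (by omega)) (by omega) (by omega)
  | star p ihp =>
    by_cases hp : m ≤ reSize p
    · obtain ⟨l, X, h1, h2, h3⟩ := ihp hp
      refine ⟨.star :: l, X, ?_, ?_, h3⟩
      · change (p.matches')∗ = (ctxEval l X)∗
        rw [h1]
      · simp only [ctxSize, Frame.size, reSize]; omega
    · refine ⟨[], _, rfl, by simpa [ctxSize] using h, ?_⟩
      exact (hsmall p (by omega)).star (by omega)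

/-- The balancing theorem, by induction on the logarithm of the size. -/
theorem balance (k : ℕ) :
    (∀ r : RegularExpression α, reSize r < 2 ^ k → HasDepth r.matches' (20 * k + 1)) ∧
    (∀ l : List (Frame α), ctxSize l < 2 ^ k → FunDepth (ctxEval l) (20 * k + 1)) := by
  induction k with
  | zero =>
    constructor
    · intro r hr
      cases r <;> simp [reSize] at hr
    · intro l hl
      cases l with
      | nil =>
        exact ⟨0, 1, 0, 1, hasDepth_zero le_rfl, hasDepth_one le_rfl, hasDepth_zero le_rfl,
          hasDepth_one le_rfl, fun X => by simp [nf, ctxEval]⟩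
      | cons f l => cases f <;> simp [ctxSize, Frame.size] at hl
  | succ k ih =>
    obtain ⟨ihE, ihK⟩ := ih
    have hpow : 2 ^ (k + 1) = 2 ^ k + 2 ^ k := by ring
    have hpos : 1 ≤ 2 ^ k := Nat.one_le_two_pow
    have hE : ∀ r : RegularExpression α, reSize r < 2 ^ (k + 1) →
        HasDepth r.matches' (20 * k + 7) := by
      intro r hr
      by_cases hs : reSize r < 2 ^ k
      · exact (ihE r hs).mono (by omega)
      · obtain ⟨l, X, h1, h2, h3⟩ := expr_split (2 ^ k) (20 * k + 1) (by omega) ihE r (by omega)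
        rw [h1]
        exact ((ihK l (by omega)).mono (e := 20 * k + 2) (by omega)).app h3
    refine ⟨fun r hr => (hE r hr).mono (by omega), fun l hl => ?_⟩
    by_cases hs : ctxSize l < 2 ^ k
    · exact (ihK l hs).mono (by omega)
    · obtain ⟨l₁, f, l₂, rfl, h1, h2, h3⟩ := ctx_split (2 ^ k) l hpos (by omega)
      have hf : FunDepth f.eval (20 * k + 7) :=
        frame_funDepth f _ (by omega) fun s hs => hE s (by omega)
      have hfl := hf.comp (by omega) ((ihK l₂ (by omega)).mono (e := 20 * k + 7) (by omega))
      have hall := ((ihK l₁ h1).mono (e := 20 * k + 7 + 7) (by omega)).comp (by omega) hfl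
      have heq : ctxEval (l₁ ++ f :: l₂) = fun X => ctxEval l₁ (f.eval (ctxEval l₂ X)) := by
        funext X
        rw [ctxEval_append]
        rfl
      rw [heq]
      exact hall.mono (by omega)

theorem starHeight_le_reDepth (r : RegularExpression α) : starHeight r ≤ reDepth r := by
  induction r <;> simp only [starHeight, reDepth] <;> omega

end Depth

/-- There is a constant `C` such that for every finite alphabet `Σ`, every regular
expression `r` over `Σ` of size `n ≥ 2` has an equivalent regular expression `r'`
with `L(r') = L(r)` whose depth is at most `C·log₂ n`; in particular, `r'` has
star height at most `C·log₂ n`. -/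
theorem stmt3 :
    ∃ C : ℝ, 0 < C ∧
      ∀ (α : Type) [Fintype α] (r : RegularExpression α) (n : ℕ),
        n = reSize r → 2 ≤ n →
        ∃ r' : RegularExpression α,
          r'.matches' = r.matches' ∧
          (reDepth r' : ℝ) ≤ C * Real.logb 2 n ∧
          (starHeight r' : ℝ) ≤ C * Real.logb 2 n := by
  refine ⟨41, by norm_num, ?_⟩
  intro α _ r n hn hn2
  obtain ⟨r', h1, h2⟩ := (balance (α := α) (Nat.log 2 n + 1)).1 r
    (by rw [← hn]; exact Nat.lt_pow_succ_log_self (by norm_num) n)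
  have hlog : (Nat.log 2 n : ℝ) ≤ Real.logb 2 n := by
    exact_mod_cast Real.natLog_le_logb n 2
  have hlog1 : (1 : ℝ) ≤ Nat.log 2 n := by
    exact_mod_cast Nat.log_pos (by norm_num) hn2
  have hd : (reDepth r' : ℝ) ≤ 20 * (Nat.log 2 n + 1) + 1 := by exact_mod_cast h2
  have hs : (starHeight r' : ℝ) ≤ reDepth r' := by exact_mod_cast starHeight_le_reDepth r'
  exact ⟨r', h1, by linarith, by linarith⟩
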